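/- Let α, β be real numbers with α > −1/2 and let x > 0 be real. If λ is a complex number with φ_λ(x) = 0, then λ is real or purely imaginary (λ ∈ ℝ ∪ iℝ). -/

import Mathlib

open MeasureTheory Real

/-- Pochhammer symbol `(x)ₙ = x (x+1) ⋯ (x+n-1)` in `ℂ`. -/
noncomputable def poch (x : ℂ) (n : ℕ) : ℂ := (ascPochhammer ℂ n).eval x

/-- The Gauss hypergeometric series `₂F₁(a,b;c;z)`. -/
noncomputable def hyp2F1 (a b c z : ℂ) : ℂ :=
  ∑' n : ℕ, poch a n * poch b n / (poch c n * (n.factorial : ℂ)) * z ^ n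

/-- The Jacobi function `φ_λ^{(α,β)}(t) = (cosh t)^{−α−β−1−iλ} ·
₂F₁((α+β+1+iλ)/2, (α−β+1+iλ)/2; α+1; tanh² t)`. -/
noncomputable def jacobiPhi (α β : ℝ) (l : ℂ) (t : ℝ) : ℂ :=
  Complex.exp ((-(α : ℂ) - (β : ℂ) - 1 - Complex.I * l) * (Real.log (Real.cosh t) : ℂ)) *
    hyp2F1 (((α : ℂ) + β + 1 + Complex.I * l) / 2)
      (((α : ℂ) - β + 1 + Complex.I * l) / 2) ((α : ℂ) + 1) ((Real.tanh t : ℂ) ^ 2)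

/-- The weight function `Δ(t) = (2 sinh t)^{2α+1} (2 cosh t)^{2β+1}`. -/
noncomputable def jacobiWeight (α β : ℝ) (t : ℝ) : ℝ :=
  (2 * Real.sinh t) ^ (2 * α + 1) * (2 * Real.cosh t) ^ (2 * β + 1)

open Filter Topology in
/-- Termwise differentiation of a power series converging on the open unit disc. -/
lemma hasSum_deriv_powerSeries {q : ℕ → ℂ}
    (h : ∀ z : ℂ, ‖z‖ < 1 → Summable fun n => q n * z ^ n) {z : ℂ} (hz : ‖z‖ < 1) :
    ∃ d : ℂ, HasSum (fun n : ℕ => ((n : ℂ) + 1) * q (n + 1) * z ^ n) d ∧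
      HasDerivAt (fun w => ∑' n, q n * w ^ n) d z := by
  obtain ⟨r, hzr, hr1⟩ := exists_between hz
  have hr0 : 0 ≤ r := (norm_nonneg z).trans hzr.le
  have hu : Summable fun n => ‖q n * (r : ℂ) ^ n‖ :=
    (h r (by simpa [abs_of_nonneg hr0] using hr1)).norm
  have hf : ∀ n : ℕ, DifferentiableOn ℂ (fun w : ℂ => q n * w ^ n) (Metric.ball 0 r) :=
    fun n => by fun_prop
  have hle : ∀ (n : ℕ) (w : ℂ), w ∈ Metric.ball (0 : ℂ) r →
      ‖q n * w ^ n‖ ≤ ‖q n * (r : ℂ) ^ n‖ := by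
    intro n w hw
    have hw' : ‖w‖ ≤ r := by simpa using (Metric.mem_ball.mp hw).le
    simp only [norm_mul, norm_pow, Complex.norm_real, Real.norm_eq_abs, abs_of_nonneg hr0]
    gcongr
  have hzb : z ∈ Metric.ball (0 : ℂ) r := by simpa using hzr
  have hs := Complex.hasSum_deriv_of_summable_norm hu hf Metric.isOpen_ball hle hzb
  have hd := (Complex.differentiableOn_tsum_of_summable_norm hu hf Metric.isOpen_ball hle).differentiableAt
    (Metric.isOpen_ball.mem_nhds hzb)
  refine ⟨_, ?_, hd.hasDerivAt⟩
  simpa [mul_comm, mul_assoc, mul_left_comm] using (hasSum_nat_add_iff' 1).mpr hs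

/-- The coefficients of the Gauss hypergeometric series. -/
noncomputable def hypCoeff (a b c : ℂ) (n : ℕ) : ℂ :=
  poch a n * poch b n / (poch c n * (n.factorial : ℂ))

lemma poch_succ (x : ℂ) (n : ℕ) : poch x (n + 1) = poch x n * (x + n) :=
  ascPochhammer_succ_eval n x

lemma hypCoeff_succ (a b : ℂ) {c : ℝ} (hc : 0 < c) (n : ℕ) :
    ((n : ℂ) + 1) * (c + n) * hypCoeff a b c (n + 1) = (a + n) * (b + n) * hypCoeff a b c n := by
  have hcn : ∀ m : ℕ, (c : ℂ) + m ≠ 0 := fun m => by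
    have : c + m ≠ 0 := by positivity
    exact_mod_cast this
  have hp : poch c n ≠ 0 := by
    induction n with
    | zero => simp [poch]
    | succ k ih => rw [poch_succ]; exact mul_ne_zero ih (hcn k)
  have h1 : (n : ℂ) + 1 ≠ 0 := by exact_mod_cast n.succ_ne_zero
  have h2 : (n.factorial : ℂ) ≠ 0 := by exact_mod_cast n.factorial_ne_zero
  have h3 := hcn n
  simp only [hypCoeff, poch_succ, Nat.factorial_succ, Nat.cast_mul, Nat.cast_add, Nat.cast_one]
  field_simp

open Filter Topology in
lemma summable_hypCoeff (a b : ℂ) {c : ℝ} (hc : 0 < c) (z : ℂ) (hz : ‖z‖ < 1) :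
    Summable fun n => hypCoeff a b c n * z ^ n := by
  obtain ⟨r, hzr, hr1⟩ := exists_between hz
  have ht : Tendsto (fun n : ℕ => ‖(a + n) / (1 + n) * ((b + n) / (c + n)) * z‖) atTop (𝓝 ‖z‖) := by
    have key : ∀ x y : ℂ, Tendsto (fun n : ℕ => (x + n) / (y + n)) atTop (𝓝 1) := fun x y => by
      simpa using tendsto_add_mul_div_add_mul_atTop_nhds x y 1 (one_ne_zero (α := ℂ))
    simpa using (((key a 1).mul (key b c)).mul_const z).norm
  refine summable_of_ratio_norm_eventually_le hr1 ?_
  filter_upwards [ht.eventually_lt_const hzr] with n hn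
  have h3 : (c : ℂ) + n ≠ 0 := by
    have : c + n ≠ 0 := by positivity
    exact_mod_cast this
  have h1 : (1 : ℂ) + n ≠ 0 := by
    rw [add_comm]; exact_mod_cast n.succ_ne_zero
  have he : hypCoeff a b c (n + 1) * z ^ (n + 1) =
      ((a + n) / (1 + n) * ((b + n) / (c + n)) * z) * (hypCoeff a b c n * z ^ n) := by
    field_simp
    linear_combination z * z ^ n * hypCoeff_succ a b hc n
  rw [he, norm_mul]
  gcongr

/-- The Gauss hypergeometric differential equation on the unit disc. -/
lemma hyp2F1_ode (a b : ℂ) {c : ℝ} (hc : 0 < c) :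
    ∃ G H : ℂ → ℂ, ∀ z : ℂ, ‖z‖ < 1 → HasDerivAt (hyp2F1 a b c) (G z) z ∧
      HasDerivAt G (H z) z ∧
      z * (1 - z) * H z + (c - (a + b + 1) * z) * G z - a * b * hyp2F1 a b c z = 0 := by
  set q := hypCoeff a b c
  set q' : ℕ → ℂ := fun n => ((n : ℂ) + 1) * q (n + 1)
  have hs : ∀ z : ℂ, ‖z‖ < 1 → Summable fun n => q n * z ^ n := summable_hypCoeff a b hc
  have hs' : ∀ z : ℂ, ‖z‖ < 1 → Summable fun n => q' n * z ^ n := fun z hz =>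
    (hasSum_deriv_powerSeries hs hz).choose_spec.1.summable
  refine ⟨fun z => ∑' n, q' n * z ^ n, fun z => ∑' n : ℕ, ((n : ℂ) + 1) * q' (n + 1) * z ^ n,
    fun z hz => ?_⟩
  obtain ⟨d, hd, hD⟩ := hasSum_deriv_powerSeries hs hz
  obtain ⟨e, he, hE⟩ := hasSum_deriv_powerSeries hs' hz
  have hF : HasSum (fun n => q n * z ^ n) (hyp2F1 a b c z) := (hs z hz).hasSum
  simp only [he.tsum_eq]
  rw [show (∑' n, q' n * z ^ n) = d from hd.tsum_eq]
  refine ⟨hD, hE, ?_⟩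
  have h1 : HasSum (fun n : ℕ => (n : ℂ) * q n * z ^ n) (z * d) := by
    refine (hasSum_nat_add_iff' 1).mp ?_
    simpa [pow_succ, mul_comm, mul_assoc, mul_left_comm] using hd.mul_left z
  have h2 : HasSum (fun n : ℕ => (n : ℂ) * q' n * z ^ n) (z * e) := by
    refine (hasSum_nat_add_iff' 1).mp ?_
    simpa [pow_succ, mul_comm, mul_assoc, mul_left_comm] using he.mul_left z
  have h3 : HasSum (fun n : ℕ => (n : ℂ) * (n - 1) * q n * z ^ n) (z * (z * e)) := by
    refine (hasSum_nat_add_iff' 1).mp ?_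
    simpa [q', pow_succ, mul_comm, mul_assoc, mul_left_comm] using h2.mul_left z
  have h4 := ((h2.add (hd.mul_left (c : ℂ))).sub h3).sub
    ((h1.mul_left (a + b + 1)).add (hF.mul_left (a * b)))
  refine Eq.trans (by ring) (h4.unique (hasSum_zero.congr_fun fun n => ?_))
  linear_combination z ^ n * hypCoeff_succ a b hc n

open Filter Topology Set in
/-- If `Im a = Im b ≠ 0` and `Re (a + b) ≠ c`, then `₂F₁(a,b;c;·)` has no zero in `(0,1)`. -/
lemma hyp2F1_ne_zero (a b : ℂ) {c : ℝ} (hc : 0 < c) (hab : a.im = b.im) (ha : a.im ≠ 0)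
    (hre : a.re + b.re ≠ c) {x : ℝ} (hx0 : 0 < x) (hx1 : x < 1) : hyp2F1 a b c x ≠ 0 := by
  intro hzero
  obtain ⟨G, H, hGH⟩ := hyp2F1_ode a b hc
  set F := hyp2F1 a b c with hFdef
  set κ : ℝ := c - a.re - b.re with hκ
  have hκ0 : κ ≠ 0 := fun h => hre (by linarith)
  set u : ℝ → ℂ := fun t => ((1 - t) * G t - a * F t) * (starRingEnd ℂ) (F t) with hu
  have hn : ∀ t ∈ Icc 0 x, ‖(t : ℂ)‖ < 1 := fun t ht => by
    rw [Complex.norm_real, Real.norm_eq_abs, abs_of_nonneg ht.1]; exact ht.2.trans_lt hx1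
  have hF' : ∀ t ∈ Icc 0 x, HasDerivAt (fun s : ℝ => F s) (G t) t := fun t ht =>
    (hGH t (hn t ht)).1.comp_ofReal
  have hG' : ∀ t ∈ Icc 0 x, HasDerivAt (fun s : ℝ => G s) (H t) t := fun t ht =>
    (hGH t (hn t ht)).2.1.comp_ofReal
  have hu' : ∀ t ∈ Icc 0 x, HasDerivAt (fun s => (u s).im)
      ((-G t + (1 - t) * H t - a * G t) * (starRingEnd ℂ) (F t) +
        ((1 - t) * G t - a * F t) * (starRingEnd ℂ) (G t)).im t := fun t ht => by
    have h1 : HasDerivAt (fun s : ℝ => (1 : ℂ) - s) (-1) t := by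
      simpa using (hasDerivAt_id t).ofReal_comp.const_sub (1 : ℂ)
    have h2 := ((h1.mul (hG' t ht)).sub ((hF' t ht).const_mul a)).mul (hF' t ht).star_conj
    have h3 := Complex.imCLM.hasFDerivAt.comp_hasDerivAt t h2
    convert! h3 using 1
    simp
  set w : ℝ → ℝ := fun t => κ * a.im * (-(t ^ c * (1 - t) ^ (-κ) * (u t).im)) with hw
  set w' : ℝ → ℝ := fun t => (κ * a.im) ^ 2 * (t ^ (c - 1) * (1 - t) ^ (-κ - 1) *
    Complex.normSq (F t)) with hw'
  have hcont : ContinuousOn w (Icc 0 x) := by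
    intro t ht
    have h1 : ContinuousAt (fun s : ℝ => s ^ c) t := Real.continuousAt_rpow_const _ _ (Or.inr hc.le)
    have h2 : ContinuousAt (fun s : ℝ => (1 - s) ^ (-κ)) t :=
      (continuousAt_const.sub continuousAt_id).rpow_const
        (Or.inl (sub_pos.2 (ht.2.trans_lt hx1)).ne')
    exact (continuousAt_const.mul ((h1.mul h2).mul (hu' t ht).continuousAt).neg).continuousWithinAt
  have hderiv : ∀ t ∈ Ioo 0 x, HasDerivAt w (w' t) t := by
    intro t ht
    have ht1 : 0 < 1 - t := sub_pos.2 (ht.2.trans hx1)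
    have htI := Ioo_subset_Icc_self ht
    have h1 : HasDerivAt (fun s : ℝ => s ^ c) (c * t ^ (c - 1)) t :=
      Real.hasDerivAt_rpow_const (Or.inl ht.1.ne')
    have h2 : HasDerivAt (fun s : ℝ => (1 - s) ^ (-κ)) (-1 * -κ * (1 - t) ^ (-κ - 1)) t :=
      ((hasDerivAt_id t).const_sub 1).rpow_const (Or.inl ht1.ne')
    have h3 := ((h1.mul h2).mul (hu' t htI)).neg.const_mul (κ * a.im)
    convert! h3 using 1
    have e1 : t ^ c = t ^ (c - 1) * t := by
      rw [← Real.rpow_add_one ht.1.ne', sub_add_cancel]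
    have e2 : (1 - t) ^ (-κ) = (1 - t) ^ (-κ - 1) * (1 - t) := by
      rw [← Real.rpow_add_one ht1.ne', sub_add_cancel]
    simp only [Pi.mul_apply, hw', hu, e1, e2]
    have hode := (hGH t (hn t htI)).2.2
    have hr := congrArg Complex.re hode
    have hi := congrArg Complex.im hode
    simp only [Complex.normSq_apply, Complex.add_re, Complex.add_im, Complex.sub_re, Complex.sub_im,
      Complex.mul_re, Complex.mul_im, Complex.neg_re, Complex.neg_im, Complex.one_re,
      Complex.one_im, Complex.ofReal_re, Complex.ofReal_im, Complex.conj_re, Complex.conj_im,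
      Complex.zero_re, Complex.zero_im] at hr hi ⊢
    rw [← hab] at hr hi
    have hb : b.re = c - a.re - κ := by rw [hκ]; ring
    rw [hb] at hr hi
    clear_value κ
    linear_combination (κ * a.im * t ^ (c - 1) * (1 - t) ^ (-κ - 1) * (1 - t)) *
      ((F t).re * hi - (F t).im * hr)
  have hnonneg : ∀ t ∈ Ioo 0 x, 0 ≤ w' t := fun t ht => by
    have ht0 := ht.1
    have ht1 : 0 < 1 - t := sub_pos.2 (ht.2.trans hx1)
    have := Complex.normSq_nonneg (F t)
    positivity
  have hmono : MonotoneOn w (Icc 0 x) := by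
    refine monotoneOn_of_deriv_nonneg (convex_Icc 0 x) hcont ?_ ?_ <;> rw [interior_Icc]
    · exact fun t ht => (hderiv t ht).differentiableAt.differentiableWithinAt
    · exact fun t ht => (hderiv t ht).deriv ▸ hnonneg t ht
  have hw0 : w 0 = 0 := by simp [hw, Real.zero_rpow hc.ne']
  have hwx : w x = 0 := by simp [hw, hu, hzero]
  have hwz : ∀ t ∈ Icc 0 x, w t = 0 := fun t ht => le_antisymm
    (hwx ▸ hmono ht (right_mem_Icc.2 hx0.le) ht.2) (hw0 ▸ hmono (left_mem_Icc.2 hx0.le) ht ht.1)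
  have hFz : ∀ t ∈ Ioo 0 x, F t = 0 := fun t ht => by
    have heq : w =ᶠ[𝓝 t] fun _ => 0 := by
      filter_upwards [Ioo_mem_nhds ht.1 ht.2] with s hs using hwz s (Ioo_subset_Icc_self hs)
    have h0 : w' t = 0 := (hderiv t ht).unique ((hasDerivAt_const t (0 : ℝ)).congr_of_eventuallyEq heq)
    have h1 := Real.rpow_pos_of_pos ht.1 (c - 1)
    have h2 := Real.rpow_pos_of_pos (sub_pos.2 (ht.2.trans hx1)) (-κ - 1)
    simpa [hw', hκ0, ha, h1.ne', h2.ne'] using h0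
  have hlim : Tendsto (fun s : ℝ => F s) (𝓝[>] 0) (𝓝 (F (0 : ℝ))) :=
    (hF' 0 (left_mem_Icc.2 hx0.le)).continuousAt.tendsto.mono_left nhdsWithin_le_nhds
  have hlim0 : Tendsto (fun s : ℝ => F s) (𝓝[>] 0) (𝓝 0) := by
    refine tendsto_const_nhds.congr' ?_
    filter_upwards [Ioo_mem_nhdsGT hx0] with s hs using (hFz s hs).symm
  have hF0 : F (0 : ℝ) = 1 := by
    rw [hFdef, hyp2F1, tsum_eq_single 0 (fun n hn => by simp [hn])]
    simp [poch]
  exact one_ne_zero (hF0 ▸ tendsto_nhds_unique hlim hlim0)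

/-- For `α > −1/2` and `x > 0`, any zero `λ` of `φ_·(x)` is real or purely
imaginary. -/
theorem stmt14 (α β : ℝ) (hα : -(1/2 : ℝ) < α) (x : ℝ) (hx : 0 < x)
    (l : ℂ) (h0 : jacobiPhi α β l x = 0) :
    l.im = 0 ∨ l.re = 0 := by
  by_contra! hne
  have hF := (mul_eq_zero.1 h0).resolve_left (Complex.exp_ne_zero _)
  have htanh : 0 < Real.tanh x := by
    rw [Real.tanh_eq_sinh_div_cosh]
    exact div_pos (Real.sinh_pos_iff.2 hx) (Real.cosh_pos x)
  have key := hyp2F1_ne_zero (((α : ℂ) + β + 1 + Complex.I * l) / 2)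
    (((α : ℂ) - β + 1 + Complex.I * l) / 2) (c := α + 1) (x := Real.tanh x ^ 2) (by linarith)
    (by simp) (by simpa using hne.2) (fun h => hne.1 (by simp at h; linarith)) (by positivity)
    (pow_lt_one₀ htanh.le (Real.tanh_lt_one x) two_ne_zero)
  exact key (by simpa using hF)
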